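/- Let S be a countable set, π : S → (0,∞), and 0 < c < ∞. Let α : S → (0,1) satisfy ∑_{x∈S} |α(x) − cπ(x)/(1+cπ(x))| < ∞. Then the product measure ν_α with marginals ν_α{η : η(x)=1} = α(x) is absolutely continuous with respect to the product measure ν^c with marginals ν^c{η : η(x)=1} = cπ(x)/(1+cπ(x)). -/

import Mathlib

open MeasureTheory Filter Topology

section Defs

variable {S : Type*}

/-- The configuration obtained from `η` by exchanging the values at sites `x` and `y`. -/
def swapConfig [DecidableEq S] (x y : S) (η : S → Bool) : S → Bool :=
  fun u => if u = x then η y else if u = y then η x else η u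

/-- A cylinder function depends on finitely many coordinates. -/
def IsCylinder (f : (S → Bool) → ℝ) : Prop :=
  ∃ F : Finset S, ∀ η ξ : S → Bool, (∀ x ∈ F, η x = ξ x) → f η = f ξ

/-- The exclusion process generator applied to a cylinder function. -/
noncomputable def exclGen [DecidableEq S] (p : S → S → ℝ) (f : (S → Bool) → ℝ)
    (η : S → Bool) : ℝ :=
  ∑' x : S, ∑' y : S,
    (if η x = true ∧ η y = false then p x y * (f (swapConfig x y η) - f η) else 0)

/-- `p` is a transition probability function with bounded column sums. -/
def IsTransition (p : S → S → ℝ) : Prop :=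
  (∀ x y, 0 ≤ p x y) ∧ (∀ x, HasSum (fun y => p x y) 1) ∧
    ∃ C : ℝ, ∀ (y : S) (F : Finset S), ∑ x ∈ F, p x y ≤ C

/-- A probability measure is invariant for the exclusion process. -/
def ExclInvariant [DecidableEq S] (p : S → S → ℝ) (μ : Measure (S → Bool)) : Prop :=
  IsProbabilityMeasure μ ∧ ∀ f : (S → Bool) → ℝ, IsCylinder f → ∫ η, exclGen p f η ∂μ = 0

/-- Extremal invariant probability measures. -/
def IsExtremalInvariant [DecidableEq S] (p : S → S → ℝ) (μ : Measure (S → Bool)) : Prop :=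
  ExclInvariant p μ ∧ ∀ (t : ℝ) (ν₁ ν₂ : Measure (S → Bool)), 0 < t → t < 1 →
    ExclInvariant p ν₁ → ExclInvariant p ν₂ →
    μ = ENNReal.ofReal t • ν₁ + ENNReal.ofReal (1 - t) • ν₂ → ν₁ = μ ∧ ν₂ = μ

/-- A reversible measure `π` for the kernel `p`. -/
def IsReversible (p : S → S → ℝ) (π : S → ℝ) : Prop :=
  (∀ x, 0 < π x) ∧ ∀ x y, π x * p x y = π y * p y x

/-- Irreducibility of `p`. -/
def IrreducibleKernel (p : S → S → ℝ) : Prop :=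
  ∀ x y : S, x ≠ y → ∃ (n : ℕ) (c : ℕ → S), c 0 = x ∧ c n = y ∧ ∀ i < n, 0 < p (c i) (c (i+1))

/-- `ν` is the product (Bernoulli) measure with marginals `α`. -/
def IsBernoulliProduct (ν : Measure (S → Bool)) (α : S → ℝ) : Prop :=
  IsProbabilityMeasure ν ∧ ∀ (F : Finset S) (a : S → Bool),
    ν {η | ∀ x ∈ F, η x = a x} = ∏ x ∈ F, ENNReal.ofReal (if a x then α x else 1 - α x)

/-- A probability measure is reversible for the exclusion process. -/
def IsReversibleMeasure [DecidableEq S] (p : S → S → ℝ) (μ : Measure (S → Bool)) : Prop :=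
  ∀ f g : (S → Bool) → ℝ, IsCylinder f → IsCylinder g →
    ∫ η, f η * exclGen p g η ∂μ = ∫ η, g η * exclGen p f η ∂μ

end Defs

/-- Finite measures on `S → Bool` that agree on all finite-dimensional cylinders are equal. -/
theorem measure_ext_of_cylinder {S : Type*} {μ ν : Measure (S → Bool)} [IsFiniteMeasure μ]
    (h : ∀ (F : Finset S) (a : S → Bool),
      μ {η | ∀ x ∈ F, η x = a x} = ν {η | ∀ x ∈ F, η x = a x}) : μ = ν := by
  classical
  refine IsProjectiveLimit.unique (P := fun F : Finset S => μ.map F.restrict) (fun F => rfl)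
    (fun F => Measure.ext_of_singleton fun b => ?_)
  have hpre : (F.restrict ⁻¹' {b} : Set (S → Bool)) =
      {η | ∀ x ∈ F, η x = (fun y => if hy : y ∈ F then b ⟨y, hy⟩ else false) x} := by
    ext η
    simp only [Set.mem_preimage, Set.mem_singleton_iff, funext_iff, Set.mem_ofPred_eq,
      Subtype.forall, Finset.restrict]
    exact forall₂_congr fun x hx => by simp [hx]
  rw [Measure.map_apply (Finset.measurable_restrict F) (measurableSet_singleton b),
    Measure.map_apply (Finset.measurable_restrict F) (measurableSet_singleton b), hpre, h]

theorem IsBernoulliProduct.unique {S : Type*} {μ ν : Measure (S → Bool)} {α : S → ℝ}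
    (hμ : IsBernoulliProduct μ α) (hν : IsBernoulliProduct ν α) : μ = ν := by
  have := hμ.1
  exact measure_ext_of_cylinder fun F a => by rw [hμ.2, hν.2]

theorem measurableSet_cylinder_eq {S : Type*} (F : Finset S) (a : S → Bool) :
    MeasurableSet {η : S → Bool | ∀ x ∈ F, η x = a x} := by
  have : {η : S → Bool | ∀ x ∈ F, η x = a x} = Set.pi F fun x => {a x} := by
    ext η
    simp [Set.mem_pi]
  rw [this]
  exact MeasurableSet.pi F.countable_toSet fun x _ => measurableSet_singleton _

theorem measurable_decide_le {S : Type*} (r : S → unitInterval) :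
    Measurable fun (u : S → unitInterval) x => decide (u x ≤ r x) :=
  measurable_pi_lambda _ fun x => measurable_to_bool <| by
    simpa [Set.preimage] using measurableSet_le (measurable_pi_apply x) measurable_const

/-- Thresholding independent uniform variables gives a Bernoulli product measure. -/
theorem isBernoulliProduct_map_decide_le {S : Type*} (r : S → unitInterval) :
    IsBernoulliProduct
      ((Measure.infinitePi fun _ : S => (volume : Measure unitInterval)).map
        fun u x => decide (u x ≤ r x))
      (fun x => (r x : ℝ)) := by
  refine ⟨Measure.isProbabilityMeasure_map (measurable_decide_le r).aemeasurable, fun F a => ?_⟩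
  have hcyl := measurableSet_cylinder_eq F a
  have hpre : (fun (u : S → unitInterval) x => decide (u x ≤ r x)) ⁻¹'
      {η | ∀ x ∈ F, η x = a x} =
      Set.pi F fun x => if a x then Set.Iic (r x) else Set.Ioi (r x) := by
    ext u
    simp only [Set.mem_preimage, Set.mem_ofPred_eq, Set.mem_pi, Finset.mem_coe]
    refine forall₂_congr fun x _ => ?_
    cases a x <;> simp
  rw [Measure.map_apply (measurable_decide_le r) hcyl, hpre, Measure.infinitePi_pi]
  · refine Finset.prod_congr rfl fun x _ => ?_
    cases a x <;> simp
  · intro x _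
    cases a x <;> simp [measurableSet_Iic, measurableSet_Ioi]

/-- Setting one coordinate to `b` amounts to conditioning on that coordinate being `b`. -/
theorem IsBernoulliProduct.smul_map_update {S : Type*} [DecidableEq S] {ν : Measure (S → Bool)}
    {α : S → ℝ} (hν : IsBernoulliProduct ν α) (x : S) (b : Bool) :
    ENNReal.ofReal (if b then α x else 1 - α x) • ν.map (fun η => Function.update η x b) =
      ν.restrict {η | η x = b} := by
  have := hν.1
  symm
  refine measure_ext_of_cylinder fun F a => ?_
  have hcyl := measurableSet_cylinder_eq F a
  have hupd : Measurable fun η : S → Bool => Function.update η x b := by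
    fun_prop
  rw [Measure.restrict_apply hcyl, Measure.smul_apply, Measure.map_apply hupd hcyl, smul_eq_mul]
  by_cases hx : x ∈ F ∧ a x ≠ b
  · have h₁ : {η : S → Bool | ∀ y ∈ F, η y = a y} ∩ {η | η x = b} = ∅ := by
      ext η
      simp only [Set.mem_inter_iff, Set.mem_ofPred_eq, Set.mem_empty_iff_false, iff_false, not_and]
      exact fun h h' => hx.2 ((h x hx.1).symm.trans h')
    have h₂ : (fun η : S → Bool => Function.update η x b) ⁻¹' {η | ∀ y ∈ F, η y = a y} = ∅ := by
      ext η
      simp only [Set.mem_preimage, Set.mem_ofPred_eq, Set.mem_empty_iff_false, iff_false]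
      exact fun h => hx.2 (by simpa using (h x hx.1).symm)
    simp [h₁, h₂]
  · have h₁ : {η : S → Bool | ∀ y ∈ F, η y = a y} ∩ {η | η x = b} =
        {η | ∀ y ∈ insert x (F.erase x), η y = Function.update a x b y} := by
      ext η
      simp only [Set.mem_inter_iff, Set.mem_ofPred_eq]
      grind
    have h₂ : (fun η : S → Bool => Function.update η x b) ⁻¹' {η | ∀ y ∈ F, η y = a y} =
        {η | ∀ y ∈ F.erase x, η y = a y} := by
      ext η
      simp only [Set.mem_preimage, Set.mem_ofPred_eq]
      grind
    rw [h₁, h₂, hν.2, hν.2, Finset.prod_insert (Finset.notMem_erase x F)]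
    congr 1
    · simp
    · refine Finset.prod_congr rfl fun y hy => ?_
      rw [Function.update_of_ne (Finset.ne_of_mem_erase hy)]

theorem IsBernoulliProduct.map_update_absolutelyContinuous {S : Type*} [DecidableEq S]
    {ν : Measure (S → Bool)} {α : S → ℝ} (hν : IsBernoulliProduct ν α)
    (hα : ∀ x, 0 < α x ∧ α x < 1) (x : S) (b : Bool) :
    ν.map (fun η => Function.update η x b) ≪ ν := by
  intro A hA
  have h : ENNReal.ofReal (if b then α x else 1 - α x) *
      ν.map (fun η => Function.update η x b) A = 0 := by
    rw [← smul_eq_mul, ← Measure.smul_apply, hν.smul_map_update]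
    exact Measure.absolutelyContinuous_restrict hA
  refine (mul_eq_zero.1 h).resolve_left (ENNReal.ofReal_pos.2 ?_).ne'
  cases b <;> simp [hα x]

theorem IsBernoulliProduct.measure_piecewise_preimage_eq_zero {S : Type*} [DecidableEq S]
    {ν : Measure (S → Bool)} {α : S → ℝ} (hν : IsBernoulliProduct ν α)
    (hα : ∀ x, 0 < α x ∧ α x < 1) (F : Finset S) (a : S → Bool) {A : Set (S → Bool)}
    (hA : ν A = 0) : ν {η | F.piecewise a η ∈ A} = 0 := by
  induction F using Finset.induction_on generalizing A with
  | empty => simpa using hA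
  | insert x F _ ih =>
    have hupd : Measurable fun η : S → Bool => Function.update η x (a x) := by
      fun_prop
    simp only [Finset.piecewise_insert]
    exact ih (A := (fun η => Function.update η x (a x)) ⁻¹' A)
      (Measure.preimage_null_of_map_null hupd.aemeasurable
        (hν.map_update_absolutelyContinuous hα x (a x) hA))

/-- The configurations having a finite modification in a null set form a null set. -/
theorem IsBernoulliProduct.measure_finite_modification_eq_zero {S : Type*} [Countable S]
    {ν : Measure (S → Bool)} {α : S → ℝ} (hν : IsBernoulliProduct ν α)
    (hα : ∀ x, 0 < α x ∧ α x < 1) {A : Set (S → Bool)} (hA : ν A = 0) :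
    ν {ξ | ∃ η ∈ A, {x | η x ≠ ξ x}.Finite} = 0 := by
  classical
  refine measure_mono_null (t := ⋃ (F : Finset S) (G : Finset S),
    {ξ | F.piecewise (fun x => decide (x ∈ G)) ξ ∈ A}) ?_
    (measure_iUnion_null fun F => measure_iUnion_null fun G =>
      hν.measure_piecewise_preimage_eq_zero hα F _ hA)
  rintro ξ ⟨η, hη, hfin⟩
  simp only [Set.mem_iUnion, Set.mem_ofPred_eq]
  refine ⟨hfin.toFinset, hfin.toFinset.filter fun x => η x, ?_⟩
  convert hη
  ext x
  by_cases hx : η x = ξ x <;> simp [Finset.piecewise, hx]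

/-- If `∑ₓ |α(x) - cπ(x)/(1+cπ(x))| < ∞`, the product measure `ν_α` is
absolutely continuous with respect to `ν^c`. -/
theorem bernoulli_absolutely_continuous {S : Type*} [Countable S]
    (π : S → ℝ) (hπ : ∀ x, 0 < π x) (c : ℝ) (hc : 0 < c)
    (α : S → ℝ) (hα : ∀ x, 0 < α x ∧ α x < 1)
    (hsum : Summable (fun x => |α x - c * π x / (1 + c * π x)|))
    (να νc : Measure (S → Bool))
    (hνα : IsBernoulliProduct να α)
    (hνc : IsBernoulliProduct νc (fun x => c * π x / (1 + c * π x))) :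
    να ≪ νc := by
  have hβ : ∀ x, 0 < c * π x / (1 + c * π x) ∧ c * π x / (1 + c * π x) < 1 := fun x => by
    have := mul_pos hc (hπ x)
    exact ⟨by positivity, (div_lt_one (by positivity)).2 (by linarith)⟩
  set P := Measure.infinitePi fun _ : S => (volume : Measure unitInterval)
  let r : S → unitInterval := fun x => ⟨α x, (hα x).1.le, (hα x).2.le⟩
  let s : S → unitInterval := fun x => ⟨c * π x / (1 + c * π x), (hβ x).1.le, (hβ x).2.le⟩
  have hr : να = P.map fun u x => decide (u x ≤ r x) :=
    hνα.unique (isBernoulliProduct_map_decide_le r)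
  have hs : νc = P.map fun u x => decide (u x ≤ s x) :=
    hνc.unique (isBernoulliProduct_map_decide_le s)
  have hdiff : ∀ᵐ u ∂P, {x | decide (u x ≤ r x) ≠ decide (u x ≤ s x)}.Finite := by
    have hle : ∀ x, P {u | decide (u x ≤ r x) ≠ decide (u x ≤ s x)} ≤
        ENNReal.ofReal |α x - c * π x / (1 + c * π x)| := fun x => by
      calc P {u | decide (u x ≤ r x) ≠ decide (u x ≤ s x)}
          ≤ P (Function.eval x ⁻¹' Set.uIoc (s x) (r x)) := measure_mono fun u hu => by
            simp only [Set.mem_ofPred_eq, ne_eq, decide_eq_decide] at hu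
            simp only [Set.mem_preimage, Function.eval, Set.mem_uIoc]
            grind
        _ = volume (Set.uIoc (s x) (r x)) :=
            (measurePreserving_eval_infinitePi _ x).measure_preimage
              measurableSet_uIoc.nullMeasurableSet
        _ = ENNReal.ofReal |α x - c * π x / (1 + c * π x)| := by
            rw [unitInterval.volume_uIoc, edist_dist, Subtype.dist_eq, Real.dist_eq]
    refine ae_finite_setOfPred_mem (μ := P)
      (s := fun x => {u : S → unitInterval | decide (u x ≤ r x) ≠ decide (u x ≤ s x)})
      (ne_top_of_le_ne_top ?_ (ENNReal.tsum_le_tsum hle))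
    rw [← ENNReal.ofReal_tsum_of_nonneg (fun _ => abs_nonneg _) hsum]
    exact ENNReal.ofReal_ne_top
  refine Measure.AbsolutelyContinuous.mk fun A hA hA0 => ?_
  have hmod := hνc.measure_finite_modification_eq_zero hβ hA0
  rw [hs] at hmod
  have hnull := Measure.preimage_null_of_map_null (measurable_decide_le s).aemeasurable hmod
  rw [hr, Measure.map_apply (measurable_decide_le r) hA]
  refine measure_mono_null_ae ?_ hnull
  filter_upwards [hdiff] with u hu hmem
  exact ⟨_, hmem, hu⟩
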